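/- Theorem D, item 1 (lifting exponential decay of correlations, derived form): Assume T is L-Lipschitz (L ≥ 1) and has (a_n)-shrinking fibers with a_n ≤ C₀·θ^n for some C₀ > 0 and θ ∈ (0,1). Let μ be a T-invariant Borel probability measure on X, μ̌ = π_*μ, and (ξ_y)_{y∈Y} a disintegration of μ over π. Fix α ∈ (0,1] and β ∈ (0,α], and assume: (a) there is C₁ > 0 such that for every bounded f : X → ℝ with Hol_α(f) < ∞ there is u : Y → ℝ with Hol_β(u) ≤ C₁·Hol_α(f), sup|u| ≤ sup|f|, and u(y) = ∫ f dξ_y for μ̌-almost every y; (b) μ̌ has exponential decay of correlations for β-Hölder observables: there are C₂ > 0 and δ ∈ (0,1) such that Corr_m^{μ̌}(u,v) ≤ C₂·(1−δ)^m·‖u‖_β·‖v‖_{L¹(μ̌)} for all m, all bounded β-Hölder u : Y → ℝ and all v ∈ L¹(μ̌). Then there exist C > 0 and η ∈ (0,1) such that for all n ∈ ℕ, every bounded α-Hölder f : X → ℝ and every g ∈ L¹(μ): Corr_n^μ(f,g) ≤ C·η^n·‖f‖_α·‖g‖_{L¹(μ)}. -/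

import Mathlib

open MeasureTheory Filter Topology Metric Set

/-- A modulus of continuity: continuous, increasing, concave on `[0,∞)`, vanishing at `0`. -/
def IsModulus (ω : ℝ → ℝ) : Prop :=
  ContinuousOn ω (Set.Ici 0) ∧ MonotoneOn ω (Set.Ici 0) ∧
    ConcaveOn ℝ (Set.Ici 0) ω ∧ ω 0 = 0 ∧ ∀ r ∈ Set.Ici (0 : ℝ), 0 ≤ ω r

/-- `T` is uniformly continuous along the fibers of `π`. -/
def UnifContAlongFibers {X Y : Type*} [PseudoMetricSpace X] (T : X → X) (π : X → Y) : Prop :=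
  ∃ ω : ℝ → ℝ, IsModulus ω ∧ ∀ x x' : X, π x = π x' → dist (T x) (T x') ≤ ω (dist x x')

/-- `T` has `(a n)`-shrinking fibers over the factor map `π`. -/
def ShrinkingFibers {X Y : Type*} [PseudoMetricSpace X] (T : X → X) (π : X → Y)
    (a : ℕ → ℝ) : Prop :=
  UnifContAlongFibers T π ∧ (∀ n, 0 < a n) ∧ Filter.Tendsto a Filter.atTop (nhds 0) ∧
    ∀ (n : ℕ) (x x' : X), π x = π x' → dist (T^[n] x) (T^[n] x') ≤ a n

/-- A function satisfying a Hölder bound with positive exponent is continuous. -/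
lemma continuous_of_abs_sub_le_mul_rpow {Z : Type*} [PseudoMetricSpace Z] {f : Z → ℝ} {H r : ℝ}
    (hr : 0 < r) (hf : ∀ x x', |f x - f x'| ≤ H * dist x x' ^ r) : Continuous f := by
  refine continuous_iff_continuousAt.2 fun x => ?_
  rw [ContinuousAt, tendsto_iff_dist_tendsto_zero]
  have hlim : Tendsto (fun z => H * dist z x ^ r) (𝓝 x) (𝓝 0) := by
    have hc : Continuous fun z => H * dist z x ^ r :=
      continuous_const.mul ((continuous_id.dist continuous_const).rpow_const fun _ => Or.inr hr.le)
    simpa [Real.zero_rpow hr.ne'] using hc.tendsto x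
  exact squeeze_zero (fun _ => dist_nonneg) (fun z => by simpa [Real.dist_eq] using hf z x) hlim

/-- A real number close to almost every value of `f` is close to the mean of `f`. -/
lemma abs_sub_integral_le_of_ae {Z : Type*} [MeasurableSpace Z] {ν : Measure Z}
    [IsProbabilityMeasure ν] {f : Z → ℝ} (hf : Integrable f ν) {c ε : ℝ}
    (h : ∀ᵐ z ∂ν, |c - f z| ≤ ε) : |c - ∫ z, f z ∂ν| ≤ ε := by
  have hc : c - ∫ z, f z ∂ν = ∫ z, (c - f z) ∂ν := by
    rw [integral_sub (integrable_const c) hf]; simp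
  rw [hc]
  simpa using norm_integral_le_of_norm_le_const (μ := ν) (f := fun z => c - f z) h

/-- The image under `p` of the signed measure `g • μ` has a density with respect to the image of
`μ`, whose `L¹` norm is at most that of `g`. -/
lemma exists_integrable_integral_comp_mul_eq {Z W : Type*} [mZ : MeasurableSpace Z]
    [mW : MeasurableSpace W] {μ : Measure Z} [IsProbabilityMeasure μ] {p : Z → W}
    (hp : Measurable p) {g : Z → ℝ} (hg : Integrable g μ) :
    ∃ v : W → ℝ, Integrable v (Measure.map p μ) ∧
      (∫ y, |v y| ∂(Measure.map p μ)) ≤ ∫ x, |g x| ∂μ ∧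
      ∀ w : W → ℝ, Measurable w → (∃ M, ∀ y, |w y| ≤ M) →
        (∫ y, w y * v y ∂(Measure.map p μ)) = ∫ x, w (p x) * g x ∂μ := by
  obtain ⟨v, hv, hvg⟩ := (stronglyMeasurable_condExp (μ := μ) (f := g)
    (m := mW.comap p)).measurable.exists_eq_measurable_comp
  have hvi : Integrable v (Measure.map p μ) := by
    rw [integrable_map_measure hv.aestronglyMeasurable hp.aemeasurable, ← hvg]
    exact integrable_condExp
  refine ⟨v, hvi, ?_, fun w hw ⟨M, hM⟩ => ?_⟩
  · rw [integral_map hp.aemeasurable hv.abs.aestronglyMeasurable]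
    have := integral_abs_condExp_le (μ := μ) (m := mW.comap p) g
    rw [hvg] at this
    exact this
  · have hwv : Measurable fun y => w y * v y := hw.mul hv
    rw [integral_map hp.aemeasurable hwv.aestronglyMeasurable]
    have hwm : StronglyMeasurable[mW.comap p] (w ∘ p) :=
      (hw.comp (comap_measurable p)).stronglyMeasurable
    have hwg : Integrable ((w ∘ p) * g) μ :=
      hg.bdd_mul (hw.comp hp).aestronglyMeasurable (Eventually.of_forall fun x => hM (p x))
    have hpull := condExp_mul_of_stronglyMeasurable_left hwm hwg hg
    have hint := integral_congr_ae hpull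
    rw [integral_condExp hp.comap_le, hvg] at hint
    exact hint.symm

/-- Splitting `n = k + m` with `k` a small fixed proportion of `n` makes both `p ^ k` and
`q ^ m * K ^ k` exponentially small. -/
lemma exists_add_eq_pow_le {p q K : ℝ} (hp : p ∈ Ioo (0 : ℝ) 1) (hq : q ∈ Ioo (0 : ℝ) 1)
    (hK : 1 ≤ K) :
    ∃ C > (0 : ℝ), ∃ η ∈ Ioo (0 : ℝ) 1, ∀ n : ℕ, ∃ k m : ℕ, k + m = n ∧
      p ^ k ≤ C * η ^ n ∧ q ^ m * K ^ k ≤ C * η ^ n := by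
  have hK0 : 0 < K := by linarith
  obtain ⟨N, hN⟩ := exists_pow_lt_of_lt_one (div_pos hq.1 hK0) hq.2
  rw [lt_div_iff₀ hK0] at hN
  set r := max p q
  have hr0 : 0 < r := lt_max_of_lt_left hp.1
  have hr1 : r < 1 := max_lt hp.2 hq.2
  set η := r ^ (((N + 1 : ℕ) : ℝ)⁻¹)
  have hη0 : 0 < η := Real.rpow_pos_of_pos hr0 _
  have hη1 : η < 1 := Real.rpow_lt_one hr0.le hr1 (by positivity)
  have hηr : η ^ (N + 1) = r := Real.rpow_inv_natCast_pow hr0.le (by omega)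
  refine ⟨r⁻¹, inv_pos.2 hr0, η, ⟨hη0, hη1⟩, fun n => ?_⟩
  have hdiv : (N + 1) * (n / (N + 1)) ≤ n := Nat.mul_div_le n (N + 1)
  have hlt : n < (N + 1) * (n / (N + 1) + 1) := Nat.lt_mul_div_succ n (by omega)
  set k := n / (N + 1)
  have hkn : k ≤ n := Nat.div_le_self _ _
  have hrk : r ^ k ≤ r⁻¹ * η ^ n := by
    rw [inv_mul_eq_div, le_div_iff₀ hr0, ← pow_succ]
    calc r ^ (k + 1) = η ^ ((N + 1) * (k + 1)) := by rw [← hηr, ← pow_mul]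
      _ ≤ η ^ n := pow_le_pow_of_le_one hη0.le hη1.le hlt.le
  refine ⟨k, n - k, by omega, (pow_le_pow_left₀ hp.1.le (le_max_left p q) k).trans hrk, ?_⟩
  have hNk : N * k ≤ n - k := by
    have : (N + 1) * k = N * k + k := by ring
    omega
  calc q ^ (n - k) * K ^ k ≤ q ^ (N * k) * K ^ k := by
        gcongr ?_ * _
        exact pow_le_pow_of_le_one hq.1.le hq.2.le hNk
    _ = (q ^ N * K) ^ k := by rw [mul_pow, pow_mul]
    _ ≤ r ^ k := by
        have := hq.1
        exact pow_le_pow_left₀ (by positivity) (hN.le.trans (le_max_right p q)) k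
    _ ≤ r⁻¹ * η ^ n := hrk

/-- If `f` is within `ε` of an observable `u ∘ π` lifted from the factor, then the correlations of
`f` are controlled by those of `u`, up to an error of order `ε`. -/
lemma abs_correlation_sub_le_of_factor {X Y : Type*} [MeasurableSpace X] [MeasurableSpace Y]
    {T : X → X} {S : Y → Y} {π : X → Y} {μ : Measure X} [IsProbabilityMeasure μ]
    (hT : MeasurePreserving T μ μ) (hS : Measurable S) (hπ : Measurable π)
    (hcomm : Function.Semiconj π T S) {f : X → ℝ} (hf : Measurable f) (hfb : ∃ M, ∀ x, |f x| ≤ M)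
    {u : Y → ℝ} (hu : Measurable u) (hub : ∃ M, ∀ y, |u y| ≤ M) {ε : ℝ}
    (hfu : ∀ᵐ x ∂μ, |f x - u (π x)| ≤ ε) {m : ℕ} {D : ℝ} (hD : 0 ≤ D)
    (hdec : ∀ v : Y → ℝ, Integrable v (Measure.map π μ) →
      |(∫ y, u (S^[m] y) * v y ∂(Measure.map π μ)) -
          (∫ y, u y ∂(Measure.map π μ)) * ∫ y, v y ∂(Measure.map π μ)| ≤
        D * ∫ y, |v y| ∂(Measure.map π μ))
    {g : X → ℝ} (hg : Integrable g μ) :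
    |(∫ x, f (T^[m] x) * g x ∂μ) - (∫ x, f x ∂μ) * ∫ x, g x ∂μ| ≤
      (2 * ε + D) * ∫ x, |g x| ∂μ := by
  obtain ⟨Mf, hMf⟩ := hfb
  obtain ⟨Mu, hMu⟩ := hub
  obtain ⟨v, hv, hvg, hvw⟩ := exists_integrable_integral_comp_mul_eq hπ hg
  have hTm : MeasurePreserving T^[m] μ μ := hT.iterate m
  have hmean_v : ∫ y, v y ∂(Measure.map π μ) = ∫ x, g x ∂μ := by
    simpa using hvw (fun _ => 1) measurable_const ⟨1, by simp⟩
  have hcor_v : ∫ y, u (S^[m] y) * v y ∂(Measure.map π μ) =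
      ∫ x, u (π (T^[m] x)) * g x ∂μ := by
    rw [hvw (fun y => u (S^[m] y)) (hu.comp (hS.iterate m)) ⟨Mu, fun y => hMu _⟩]
    simp_rw [(hcomm.iterate_right m).eq]
  have hmean_u : ∫ y, u y ∂(Measure.map π μ) = ∫ x, u (π x) ∂μ :=
    integral_map hπ.aemeasurable hu.aestronglyMeasurable
  have hfi : Integrable f μ :=
    Integrable.of_bound hf.aestronglyMeasurable Mf (Eventually.of_forall hMf)
  have hui : Integrable (fun x => u (π x)) μ :=
    Integrable.of_bound (hu.comp hπ).aestronglyMeasurable Mu (Eventually.of_forall fun x => hMu _)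
  have hcor : |(∫ x, f (T^[m] x) * g x ∂μ) - ∫ x, u (π (T^[m] x)) * g x ∂μ| ≤
      ε * ∫ x, |g x| ∂μ := by
    have hfg : Integrable (fun x => f (T^[m] x) * g x) μ :=
      hg.bdd_mul (hf.comp hTm.measurable).aestronglyMeasurable
        (Eventually.of_forall fun x => hMf _)
    have hug : Integrable (fun x => u (π (T^[m] x)) * g x) μ :=
      hg.bdd_mul (hu.comp (hπ.comp hTm.measurable)).aestronglyMeasurable
        (Eventually.of_forall fun x => hMu _)
    rw [← integral_sub hfg hug, ← integral_const_mul, ← Real.norm_eq_abs]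
    refine norm_integral_le_of_norm_le (hg.abs.const_mul ε) ?_
    filter_upwards [hTm.quasiMeasurePreserving.ae hfu] with x hx
    rw [← sub_mul, norm_mul]
    exact mul_le_mul_of_nonneg_right hx (abs_nonneg _)
  have hmean : |(∫ x, u (π x) ∂μ) - ∫ x, f x ∂μ| ≤ ε := by
    rw [← integral_sub hui hfi]
    have h := norm_integral_le_of_norm_le_const (μ := μ) (f := fun x => u (π x) - f x) (C := ε)
      (by filter_upwards [hfu] with x hx; rwa [Real.norm_eq_abs, abs_sub_comm])
    simpa using h
  have hmean_mul : |((∫ x, u (π x) ∂μ) - ∫ x, f x ∂μ) * ∫ x, g x ∂μ| ≤ ε * ∫ x, |g x| ∂μ := by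
    rw [abs_mul]
    exact mul_le_mul hmean abs_integral_le_integral_abs (abs_nonneg _)
      ((abs_nonneg _).trans hmean)
  have hmid := (hdec v hv).trans (mul_le_mul_of_nonneg_left hvg hD)
  rw [hcor_v, hmean_v, hmean_u] at hmid
  rw [abs_le] at hcor hmean_mul hmid ⊢
  constructor <;> linarith [hcor.1, hcor.2, hmean_mul.1, hmean_mul.2, hmid.1, hmid.2]

/-- Theorem D, item 1 (derived form): exponentially shrinking fibers, a Lipschitz `T`, a
disintegration regular from `α`-Hölder on `X` to `β`-Hölder on `Y`, and exponential decay
of correlations for `(S, μY)` on `β`-Hölder observables imply exponential decay of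
correlations for `(T, μ)` on `α`-Hölder observables. -/
theorem lifting_exponential_decay_of_correlations
    {X Y : Type*} [MetricSpace X] [CompactSpace X] [MeasurableSpace X] [BorelSpace X]
    [MetricSpace Y] [CompactSpace Y] [MeasurableSpace Y] [BorelSpace Y]
    (T : X → X) (S : Y → Y) (π : X → Y)
    (hT : Measurable T) (hS : Measurable S)
    (L : ℝ) (hL : 1 ≤ L) (hTLip : LipschitzWith (Real.toNNReal L) T)
    (hπc : Continuous π) (hπs : Function.Surjective π)
    (hcomm : ∀ x, π (T x) = S (π x))
    (a : ℕ → ℝ) (hshrink : ShrinkingFibers T π a)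
    (C₀ : ℝ) (hC₀ : 0 < C₀) (θ : ℝ) (hθ : θ ∈ Set.Ioo (0 : ℝ) 1)
    (ha : ∀ n, a n ≤ C₀ * θ ^ n)
    (μ : Measure X) [IsProbabilityMeasure μ] (hμinv : Measure.map T μ = μ)
    -- `ξ` is a disintegration of `μ` over `π`:
    (ξ : Y → Measure X) (hξmeas : Measurable ξ)
    (hξprob : ∀ y, IsProbabilityMeasure (ξ y))
    (hξconc : ∀ y, ξ y (π ⁻¹' {y}) = 1)
    (hξdis : ∀ f : X → ℝ, Measurable f → (∃ M, ∀ x, |f x| ≤ M) →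
      (∫ y, (∫ x, f x ∂(ξ y)) ∂(Measure.map π μ)) = ∫ x, f x ∂μ)
    (α : ℝ) (hα : α ∈ Set.Ioc (0 : ℝ) 1) (β : ℝ) (hβ : β ∈ Set.Ioc (0 : ℝ) α)
    -- (a) regularity of the disintegration:
    (C₁ : ℝ) (hC₁ : 0 < C₁)
    (hreg : ∀ f : X → ℝ, (∃ M, ∀ x, |f x| ≤ M) →
      ∀ H : ℝ, 0 ≤ H → (∀ x x' : X, |f x - f x'| ≤ H * dist x x' ^ α) →
      ∃ u : Y → ℝ,
        (∀ y y' : Y, |u y - u y'| ≤ C₁ * H * dist y y' ^ β) ∧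
        (∀ y, |u y| ≤ ⨆ x : X, |f x|) ∧
        ∀ᵐ y ∂(Measure.map π μ), u y = ∫ x, f x ∂(ξ y))
    -- (b) exponential decay of correlations for `(S, π_* μ)` on `β`-Hölder observables:
    (C₂ : ℝ) (hC₂ : 0 < C₂) (δ : ℝ) (hδ : δ ∈ Set.Ioo (0 : ℝ) 1)
    (hdecS : ∀ (m : ℕ) (u : Y → ℝ), (∃ M, ∀ y, |u y| ≤ M) →
      ∀ Hu : ℝ, 0 ≤ Hu → (∀ y y' : Y, |u y - u y'| ≤ Hu * dist y y' ^ β) →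
      ∀ v : Y → ℝ, Integrable v (Measure.map π μ) →
        |(∫ y, u (S^[m] y) * v y ∂(Measure.map π μ)) -
            (∫ y, u y ∂(Measure.map π μ)) * ∫ y, v y ∂(Measure.map π μ)| ≤
          C₂ * (1 - δ) ^ m * ((⨆ y : Y, |u y|) + Hu) * ∫ y, |v y| ∂(Measure.map π μ)) :
    ∃ C > (0 : ℝ), ∃ η ∈ Set.Ioo (0 : ℝ) 1,
      ∀ (n : ℕ) (f : X → ℝ), (∃ M, ∀ x, |f x| ≤ M) →
        ∀ H : ℝ, 0 ≤ H → (∀ x x' : X, |f x - f x'| ≤ H * dist x x' ^ α) →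
        ∀ g : X → ℝ, Integrable g μ →
          |(∫ x, f (T^[n] x) * g x ∂μ) - (∫ x, f x ∂μ) * ∫ x, g x ∂μ| ≤
            C * η ^ n * ((⨆ x : X, |f x|) + H) * ∫ x, |g x| ∂μ := by
  obtain ⟨hα0, hα1⟩ := hα
  obtain ⟨hβ0, hβα⟩ := hβ
  have hL0 : 0 ≤ L := by linarith
  have hδ0 : 0 < 1 - δ := by linarith [hδ.2]
  have : Nonempty X := μ.nonempty_of_neZero
  have : Nonempty Y := this.map π
  obtain ⟨C, hC, η, hη, hsplit⟩ := exists_add_eq_pow_le (p := θ ^ α) (q := 1 - δ) (K := L ^ α)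
    ⟨Real.rpow_pos_of_pos hθ.1 _, Real.rpow_lt_one hθ.1.le hθ.2 hα0⟩
    ⟨hδ0, by linarith [hδ.1]⟩ (Real.one_le_rpow hL hα0.le)
  refine ⟨(2 * C₀ ^ α + C₂ * (1 + C₁)) * C, by positivity, η, hη, ?_⟩
  intro n f ⟨M, hM⟩ H hH hf g hg
  obtain ⟨k, m, rfl, hk, hm⟩ := hsplit n
  have hfle : ∀ x, |f x| ≤ ⨆ x, |f x| := le_ciSup ⟨M, by rintro _ ⟨x, rfl⟩; exact hM x⟩
  set F := ⨆ x, |f x|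
  have hF0 : 0 ≤ F := (abs_nonneg _).trans (hfle (Classical.arbitrary X))
  have hTk : LipschitzWith (Real.toNNReal L ^ k) T^[k] := hTLip.iterate k
  have hfkH : ∀ x x', |f (T^[k] x) - f (T^[k] x')| ≤ (H * (L ^ α) ^ k) * dist x x' ^ α := by
    intro x x'
    have hd : dist (T^[k] x) (T^[k] x') ≤ L ^ k * dist x x' := by
      simpa [Real.coe_toNNReal L hL0] using hTk.dist_le_mul x x'
    calc |f (T^[k] x) - f (T^[k] x')| ≤ H * dist (T^[k] x) (T^[k] x') ^ α := hf _ _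
      _ ≤ H * (L ^ k * dist x x') ^ α := by gcongr
      _ = (H * (L ^ α) ^ k) * dist x x' ^ α := by
          rw [Real.mul_rpow (by positivity) dist_nonneg, ← Real.rpow_pow_comm hL0, mul_assoc]
  have hfc : Continuous fun x => f (T^[k] x) := continuous_of_abs_sub_le_mul_rpow hα0 hfkH
  set ε := H * (C₀ ^ α * (θ ^ α) ^ k) with hε
  have hosc : ∀ x x', π x = π x' → |f (T^[k] x) - f (T^[k] x')| ≤ ε := by
    intro x x' hxx'
    have hθ0 := hθ.1
    calc |f (T^[k] x) - f (T^[k] x')| ≤ H * dist (T^[k] x) (T^[k] x') ^ α := hf _ _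
      _ ≤ H * (C₀ * θ ^ k) ^ α := by
          gcongr
          exact (hshrink.2.2.2 k x x' hxx').trans (ha k)
      _ = ε := by rw [Real.mul_rpow hC₀.le (by positivity), ← Real.rpow_pow_comm hθ0.le]
  obtain ⟨u, huH, hub, hu⟩ := hreg (fun x => f (T^[k] x)) ⟨M, fun x => hM _⟩
    (H * (L ^ α) ^ k) (by positivity) hfkH
  have huF : ∀ y, |u y| ≤ F := fun y => (hub y).trans (ciSup_le fun x => hfle _)
  have huc : Continuous u := continuous_of_abs_sub_le_mul_rpow hβ0 huH
  have hfu : ∀ᵐ x ∂μ, |f (T^[k] x) - u (π x)| ≤ ε := by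
    filter_upwards [ae_of_ae_map hπc.measurable.aemeasurable hu] with x hx
    have := hξprob (π x)
    rw [hx]
    refine abs_sub_integral_le_of_ae (Integrable.of_bound hfc.aestronglyMeasurable M
      (Eventually.of_forall fun x => hM _)) ?_
    have hfib : ∀ᵐ x' ∂(ξ (π x)), x' ∈ π ⁻¹' {π x} :=
      (mem_ae_iff_prob_eq_one (hπc.measurable (measurableSet_singleton _))).2 (hξconc (π x))
    filter_upwards [hfib] with x' hx'
    exact hosc x x' hx'.symm
  have hTp : MeasurePreserving T μ μ := ⟨hT, hμinv⟩
  have hmean : ∫ x, f (T^[k] x) ∂μ = ∫ x, f x ∂μ := by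
    have hfm : AEStronglyMeasurable f (Measure.map T^[k] μ) :=
      (continuous_of_abs_sub_le_mul_rpow hα0 hf).aestronglyMeasurable
    rw [← integral_map (hTp.iterate k).measurable.aemeasurable hfm, (hTp.iterate k).map_eq]
  have hcor := abs_correlation_sub_le_of_factor hTp hS hπc.measurable hcomm hfc.measurable
    ⟨M, fun x => hM _⟩ huc.measurable ⟨F, huF⟩ hfu
    (D := C₂ * (1 - δ) ^ m * ((⨆ y, |u y|) + C₁ * (H * (L ^ α) ^ k)))
    (mul_nonneg (by positivity) (add_nonneg (Real.iSup_nonneg fun _ => abs_nonneg _)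
      (by positivity)))
    (hdecS m u ⟨F, huF⟩ _ (by positivity) huH) hg
  simp_rw [← Function.iterate_add_apply] at hcor
  rw [hmean] at hcor
  refine hcor.trans (mul_le_mul_of_nonneg_right ?_ (integral_nonneg fun _ => abs_nonneg _))
  have hm' : (1 - δ) ^ m ≤ C * η ^ (k + m) :=
    (le_mul_of_one_le_right (by positivity)
      (one_le_pow₀ (Real.one_le_rpow hL hα0.le))).trans hm
  set E := C * η ^ (k + m) with hE
  have hE0 : 0 ≤ E := by have := hη.1; positivity
  calc 2 * ε + C₂ * (1 - δ) ^ m * ((⨆ y, |u y|) + C₁ * (H * (L ^ α) ^ k))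
      ≤ 2 * ε + C₂ * (1 - δ) ^ m * (F + C₁ * (H * (L ^ α) ^ k)) := by
        gcongr
        exact ciSup_le huF
    _ = 2 * C₀ ^ α * H * (θ ^ α) ^ k + C₂ * F * (1 - δ) ^ m +
          C₂ * C₁ * H * ((1 - δ) ^ m * (L ^ α) ^ k) := by rw [hε]; ring
    _ ≤ 2 * C₀ ^ α * H * E + C₂ * F * E + C₂ * C₁ * H * E := by gcongr
    _ ≤ (2 * C₀ ^ α * H * E + C₂ * F * E + C₂ * C₁ * H * E) +
          (2 * C₀ ^ α * F * E + C₂ * H * E + C₂ * C₁ * F * E) :=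
        le_add_of_nonneg_right (by positivity)
    _ = (2 * C₀ ^ α + C₂ * (1 + C₁)) * C * η ^ (k + m) * (F + H) := by rw [hE]; ring
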